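/- If K and each L_k are homology spheres (reduced homology isomorphic to ℤ concentrated in one degree), then the composition complex S(K; L₁, …, L_m) is a homology sphere; moreover if H̃_{a}(K) ≅ ℤ and H̃_{b_k}(L_k) ≅ ℤ then H̃_{c}(S(K; L₁,…,L_m)) ≅ ℤ with c = a + b₁ + ⋯ + b_m + m. -/

import Mathlib

/-- A (possibly void) abstract simplicial complex: a set of finite subsets
closed under taking subsets. -/
def IsComplex {V : Type*} (K : Set (Finset V)) : Prop :=
  ∀ s ∈ K, ∀ t ⊆ s, t ∈ K

/-- The blockwise join-union of complexes `Y k` on pairwise disjoint vertex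
blocks `B k ⊆ ℕ`. -/
def joinU {m : ℕ} (B : Fin m → Finset ℕ) (Y : Fin m → Set (Finset ℕ)) :
    Set (Finset ℕ) :=
  {σ | σ ⊆ Finset.univ.biUnion B ∧ ∀ k, σ ∩ B k ∈ Y k}

/-- The polyhedral product complex `S(K; X, A)` on blocks `B k`. -/
def compU {m : ℕ} (B : Fin m → Finset ℕ) (K : Set (Finset (Fin m)))
    (X A : Fin m → Set (Finset ℕ)) : Set (Finset ℕ) :=
  ⋃ τ ∈ K, joinU B (fun k => if k ∈ τ then X k else A k)

/-- The full simplex on a finite vertex set `T`. -/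
def fullOn (T : Finset ℕ) : Set (Finset ℕ) := {s | s ⊆ T}

/-- The group of (shifted-degree) reduced simplicial chains of `K` in degree
`n`: the free abelian group on the simplices of `K` of cardinality `n`
(so the empty simplex sits in degree `0`). -/
abbrev chainsOf {V : Type*} (K : Set (Finset V)) (n : ℕ) : Type _ :=
  {s : Finset V // s ∈ K ∧ s.card = n} →₀ ℤ

open Finset Classical in
/-- The simplicial boundary map, with the alternating signs determined by the
linear order on the vertices. -/
noncomputable def bdry {V : Type*} [LinearOrder V] (K : Set (Finset V))
    (n : ℕ) : chainsOf K (n + 1) →ₗ[ℤ] chainsOf K n :=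
  Finsupp.lsum ℤ fun s =>
    ∑ i ∈ s.1.attach,
      if h : s.1.erase i.1 ∈ K then
        ((-1 : ℤ) ^ ((s.1.filter fun x => x < i.1)).card) •
          Finsupp.lsingle
            ⟨s.1.erase i.1, h, by
              rw [Finset.card_erase_of_mem i.2, s.2.2]; rfl⟩
      else 0

/-- Reduced cycles (everything in degree 0 is a cycle). -/
noncomputable def cyc {V : Type*} [LinearOrder V] (K : Set (Finset V)) :
    ∀ n : ℕ, Submodule ℤ (chainsOf K n)
  | 0 => ⊤
  | n + 1 => LinearMap.ker (bdry K n)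

/-- The (shifted) reduced simplicial homology group of `K`:
`Hgrp K n ≅ H̃_{n-1}(K)`. -/
abbrev Hgrp {V : Type*} [LinearOrder V] (K : Set (Finset V)) (n : ℕ) :
    Type _ :=
  cyc K n ⧸ Submodule.comap (cyc K n).subtype (LinearMap.range (bdry K n))

/-! ### The ambient complex on all finite sets of vertices -/

section Ambient

variable {V : Type*} [LinearOrder V]

/-- Chains on all finite subsets of `V`. -/
abbrev AmbientChain (V : Type*) : Type _ := Finset V →₀ ℤ

/-- The submodule of ambient chains supported on the family `X`. -/
abbrev chainsOn {V : Type*} (X : Set (Finset V)) : Submodule ℤ (AmbientChain V) :=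
  Finsupp.supported ℤ ℤ X

/-- The simplex `s` as a chain. -/
noncomputable abbrev face {V : Type*} (s : Finset V) : AmbientChain V := Finsupp.single s 1

theorem face_mem_chainsOn {V : Type*} {X : Set (Finset V)} {s : Finset V} (h : s ∈ X) :
    face s ∈ chainsOn X :=
  Finsupp.single_mem_supported ℤ 1 h

theorem chainsOn_eq_span {V : Type*} (X : Set (Finset V)) :
    chainsOn X = Submodule.span ℤ (face '' X) :=
  Finsupp.supported_eq_span_single ℤ X

theorem map_mem_of_face_mem {V M : Type*} [AddCommGroup M]
    {X : Set (Finset V)} {f : AmbientChain V →ₗ[ℤ] M} {N : Submodule ℤ M}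
    (h : ∀ s ∈ X, f (face s) ∈ N) {x : AmbientChain V} (hx : x ∈ chainsOn X) : f x ∈ N := by
  have : chainsOn X ≤ N.comap f := by
    rw [chainsOn_eq_span, Submodule.span_le]
    rintro _ ⟨s, hs, rfl⟩
    exact h s hs
  exact this hx

theorem eq_of_face_eq {V M : Type*} [AddCommGroup M]
    {X : Set (Finset V)} {f g : AmbientChain V →ₗ[ℤ] M}
    (h : ∀ s ∈ X, f (face s) = g (face s)) {x : AmbientChain V} (hx : x ∈ chainsOn X) :
    f x = g x := by
  rw [chainsOn_eq_span] at hx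
  refine LinearMap.eqOn_span (f := f) (g := g) ?_ hx
  rintro _ ⟨s, hs, rfl⟩
  exact h s hs

theorem mem_chainsOn_univ {V : Type*} (x : AmbientChain V) : x ∈ chainsOn (Set.univ) := by
  simp [chainsOn]

/-- The linear map with prescribed values on simplices. -/
noncomputable abbrev onFaces {V M : Type*} [AddCommGroup M] (v : Finset V → M) :
    AmbientChain V →ₗ[ℤ] M :=
  Finsupp.linearCombination ℤ v

theorem onFaces_face {V M : Type*} [AddCommGroup M] (v : Finset V → M) (s : Finset V) :
    onFaces v (face s) = v s := by
  simp [onFaces, face]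

/-- The sign obtained by moving `i` past the elements of `s` smaller than `i`. -/
def passSign (s : Finset V) (i : V) : ℤ := ∏ j ∈ s, if j < i then -1 else 1

theorem passSign_eq (s : Finset V) (i : V) :
    passSign s i = (-1) ^ (s.filter fun x => x < i).card := by
  simp [passSign, Finset.prod_ite]

theorem passSign_mul_self (s : Finset V) (i : V) : passSign s i * passSign s i = 1 := by
  rw [passSign_eq, ← mul_pow]; simp

theorem passSign_union {s t : Finset V} (h : Disjoint s t) (i : V) :
    passSign (s ∪ t) i = passSign s i * passSign t i :=
  Finset.prod_union h

/-- The sign of the shuffle sorting `t` followed by `x`. -/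
def shuffleSign (t x : Finset V) : ℤ := ∏ i ∈ t, passSign x i

theorem shuffleSign_mul_self (t x : Finset V) : shuffleSign t x * shuffleSign t x = 1 := by
  rw [shuffleSign, ← Finset.prod_mul_distrib]
  exact Finset.prod_eq_one fun i _ => passSign_mul_self x i

theorem shuffleSign_erase_left {t x : Finset V} {i : V} (hi : i ∈ t) :
    shuffleSign t x = passSign x i * shuffleSign (t.erase i) x :=
  (Finset.mul_prod_erase t (passSign x) hi).symm

theorem shuffleSign_erase_right {t x : Finset V} {i : V} (hi : i ∈ x) (ht : i ∉ t) :
    shuffleSign t x * passSign t i = (-1) ^ t.card * shuffleSign t (x.erase i) := by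
  rw [shuffleSign, shuffleSign, passSign, ← Finset.prod_mul_distrib, ← Finset.prod_const,
    ← Finset.prod_mul_distrib]
  refine Finset.prod_congr rfl fun k hk => ?_
  have hne : k ≠ i := fun h => ht (h ▸ hk)
  rw [passSign, ← Finset.mul_prod_erase x _ hi, ← passSign]
  rcases lt_or_gt_of_ne hne with h | h
  · simp [h, h.not_gt]
  · simp [h, h.not_gt]

/-- The ambient boundary operator. -/
noncomputable def dif : AmbientChain V →ₗ[ℤ] AmbientChain V :=
  onFaces fun s => ∑ i ∈ s, passSign s i • face (s.erase i)

theorem dif_face (s : Finset V) :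
    dif (face s) = ∑ i ∈ s, passSign s i • face (s.erase i) :=
  onFaces_face _ s

@[simp] theorem dif_face_empty : dif (face (∅ : Finset V)) = 0 := by
  simp [dif_face]

@[simp] theorem dif_face_singleton (v : V) : dif (face {v}) = face (∅ : Finset V) := by
  rw [dif_face]; simp [passSign]

/-- Multiplication by the simplex `t` from the left. -/
noncomputable def wedgeFace (t : Finset V) : AmbientChain V →ₗ[ℤ] AmbientChain V :=
  onFaces fun x => shuffleSign t x • face (t ∪ x)

theorem wedgeFace_face (t x : Finset V) :
    wedgeFace t (face x) = shuffleSign t x • face (t ∪ x) :=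
  onFaces_face _ x

/-- The exterior product of chains (meaningful for disjoint simplices). -/
noncomputable def wedge : AmbientChain V →ₗ[ℤ] AmbientChain V →ₗ[ℤ] AmbientChain V :=
  onFaces wedgeFace

theorem wedge_face (t : Finset V) : wedge (face t) = wedgeFace t :=
  onFaces_face _ t

theorem wedge_face_face (t x : Finset V) :
    wedge (face t) (face x) = shuffleSign t x • face (t ∪ x) := by
  rw [wedge_face, wedgeFace_face]

theorem face_union (t x : Finset V) :
    face (t ∪ x) = shuffleSign t x • wedge (face t) (face x) := by
  rw [wedge_face_face, smul_smul, shuffleSign_mul_self, one_smul]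

theorem dif_wedge_face {t x : Finset V} (h : Disjoint t x) :
    dif (wedge (face t) (face x)) =
      wedge (dif (face t)) (face x) + (-1 : ℤ) ^ t.card • wedge (face t) (dif (face x)) := by
  rw [wedge_face_face, map_smul, dif_face, dif_face, dif_face, Finset.sum_union h, smul_add,
    Finset.smul_sum, Finset.smul_sum, map_sum, LinearMap.sum_apply, map_sum, Finset.smul_sum]
  congr 1
  · refine Finset.sum_congr rfl fun i hi => ?_
    have hx : i ∉ x := Finset.disjoint_left.1 h hi
    rw [map_smul, LinearMap.smul_apply, wedge_face_face, smul_smul, smul_smul,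
      shuffleSign_erase_left hi, passSign_union h, Finset.erase_union_distrib,
      Finset.erase_eq_of_notMem hx]
    congr 1
    linear_combination (passSign t i * shuffleSign (t.erase i) x) * passSign_mul_self x i
  · refine Finset.sum_congr rfl fun i hi => ?_
    have ht : i ∉ t := Finset.disjoint_right.1 h hi
    rw [map_smul, wedge_face_face, smul_smul, smul_smul, smul_smul, passSign_union h,
      Finset.erase_union_distrib, Finset.erase_eq_of_notMem ht]
    congr 1
    linear_combination passSign x i * shuffleSign_erase_right hi ht

theorem dif_wedge {B t : Finset V} (h : Disjoint t B) {y : AmbientChain V}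
    (hy : y ∈ chainsOn (fun s => s ⊆ B)) :
    dif (wedge (face t) y) =
      wedge (dif (face t)) y + (-1 : ℤ) ^ t.card • wedge (face t) (dif y) :=
  eq_of_face_eq (f := dif ∘ₗ wedge (face t))
    (g := wedge (dif (face t)) + (-1 : ℤ) ^ t.card • wedge (face t) ∘ₗ dif)
    (fun _ hs => dif_wedge_face (h.mono_right hs)) hy

theorem dif_mem {X : Set (Finset V)} (hX : IsComplex X) {x : AmbientChain V}
    (hx : x ∈ chainsOn X) : dif x ∈ chainsOn X := by
  refine map_mem_of_face_mem (fun s hs => ?_) hx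
  rw [dif_face]
  exact Submodule.sum_mem _ fun i _ => Submodule.smul_mem _ _
    (face_mem_chainsOn (hX s hs _ (Finset.erase_subset _ _)))

theorem isComplex_subsets {V : Type*} (B : Finset V) : IsComplex (fun s => s ⊆ B) :=
  fun _ hs _ ht => ht.trans hs

theorem dif_dif_face (s : Finset V) : dif (dif (face s)) = 0 := by
  induction s using Finset.induction_on with
  | empty => simp
  | insert a s ha ih =>
    have hd : Disjoint {a} s := Finset.disjoint_singleton_left.2 ha
    have hs : face s ∈ chainsOn (fun t => t ⊆ s) := face_mem_chainsOn (Finset.Subset.refl s)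
    have hone : ∀ y : AmbientChain V, wedge (face ∅) y = y := fun y =>
      eq_of_face_eq (g := LinearMap.id)
        (fun t _ => by simp [wedge_face_face, shuffleSign]) (mem_chainsOn_univ y)
    rw [Finset.insert_eq, face_union, map_smul, map_smul, dif_wedge hd hs, map_add, map_smul,
      dif_wedge hd (dif_mem (isComplex_subsets s) hs), ih, dif_face_singleton, hone, hone]
    simp

theorem dif_dif (x : AmbientChain V) : dif (dif x) = 0 := by
  have h : (dif ∘ₗ dif : AmbientChain V →ₗ[ℤ] AmbientChain V) = 0 :=
    Finsupp.lhom_ext' fun s => LinearMap.ext_ring (dif_dif_face s)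
  exact LinearMap.congr_fun h x

/-! ### Extending operators on a block -/

/-- Extend an operator `f` on the chains of the block `B` to all chains, twisted by a
scalar `c` depending on the part of the simplex outside `B`. -/
noncomputable def hat (B : Finset V) (c : Finset V → ℤ)
    (f : AmbientChain V →ₗ[ℤ] AmbientChain V) : AmbientChain V →ₗ[ℤ] AmbientChain V :=
  onFaces fun s =>
    (shuffleSign (s \ B) (s ∩ B) * c (s \ B)) • wedge (face (s \ B)) (f (face (s ∩ B)))

theorem hat_face (B : Finset V) (c : Finset V → ℤ) (f : AmbientChain V →ₗ[ℤ] AmbientChain V)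
    (s : Finset V) : hat B c f (face s) =
      (shuffleSign (s \ B) (s ∩ B) * c (s \ B)) • wedge (face (s \ B)) (f (face (s ∩ B))) :=
  onFaces_face _ s

theorem hat_wedge_face {B : Finset V} (c : Finset V → ℤ)
    (f : AmbientChain V →ₗ[ℤ] AmbientChain V) {t : Finset V} (h : Disjoint t B)
    {y : AmbientChain V} (hy : y ∈ chainsOn (fun s => s ⊆ B)) :
    hat B c f (wedge (face t) y) = c t • wedge (face t) (f y) := by
  refine eq_of_face_eq (f := hat B c f ∘ₗ wedge (face t)) (g := c t • wedge (face t) ∘ₗ f)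
    (fun x hx => ?_) hy
  have hx : x ⊆ B := hx
  have h1 : (t ∪ x) \ B = t := by
    rw [Finset.union_sdiff_distrib, Finset.sdiff_eq_self_of_disjoint h,
      Finset.sdiff_eq_empty_iff_subset.2 hx, Finset.union_empty]
  have h2 : (t ∪ x) ∩ B = x := by
    rw [Finset.union_inter_distrib_right, Finset.disjoint_iff_inter_eq_empty.1 h,
      Finset.inter_eq_left.2 hx, Finset.empty_union]
  simp only [LinearMap.comp_apply, LinearMap.smul_apply]
  rw [wedge_face_face, map_smul, hat_face, h1, h2, smul_smul, ← mul_assoc,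
    shuffleSign_mul_self, one_mul]

theorem hat_wedge {B : Finset V} {c : Finset V → ℤ} {c₀ : ℤ}
    (f : AmbientChain V →ₗ[ℤ] AmbientChain V) {τ : AmbientChain V}
    (hτ : τ ∈ chainsOn (fun t => Disjoint t B ∧ c t = c₀))
    {y : AmbientChain V} (hy : y ∈ chainsOn (fun s => s ⊆ B)) :
    hat B c f (wedge τ y) = c₀ • wedge τ (f y) := by
  refine eq_of_face_eq (f := hat B c f ∘ₗ wedge.flip y) (g := c₀ • wedge.flip (f y))
    (fun t ht => ?_) hτ
  obtain ⟨h, rfl⟩ := ht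
  simpa using hat_wedge_face c f h hy

theorem face_eq_wedge (B s : Finset V) :
    face s = shuffleSign (s \ B) (s ∩ B) • wedge (face (s \ B)) (face (s ∩ B)) := by
  rw [← face_union, Finset.sdiff_union_inter]

theorem hat_id (B : Finset V) (x : AmbientChain V) :
    hat B (fun _ => 1) LinearMap.id x = x :=
  eq_of_face_eq (g := LinearMap.id)
    (fun s _ => by simp [hat_face, ← face_eq_wedge]) (mem_chainsOn_univ x)

theorem dif_face_mem_off {B t : Finset V} (h : Disjoint t B) :
    dif (face t) ∈ chainsOn (fun s => Disjoint s B ∧ (-1 : ℤ) ^ s.card = -(-1) ^ t.card) := by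
  rw [dif_face]
  refine Submodule.sum_mem _ fun i hi => Submodule.smul_mem _ _ (face_mem_chainsOn ⟨?_, ?_⟩)
  · exact h.mono_left (Finset.erase_subset _ _)
  · rw [← Finset.card_erase_add_one hi, pow_succ]; ring

theorem hat_wedge_dif_one {B t : Finset V} (h : Disjoint t B)
    (f : AmbientChain V →ₗ[ℤ] AmbientChain V)
    {y : AmbientChain V} (hy : y ∈ chainsOn (fun s => s ⊆ B)) :
    hat B (fun _ => 1) f (wedge (dif (face t)) y) = wedge (dif (face t)) (f y) := by
  rw [hat_wedge (c₀ := 1) f _ hy, one_smul]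
  have hle : {s | Disjoint s B ∧ (-1 : ℤ) ^ s.card = -(-1) ^ t.card} ⊆
      {s | Disjoint s B ∧ (1 : ℤ) = 1} := fun s hs => ⟨hs.1, rfl⟩
  exact Finsupp.supported_mono hle (dif_face_mem_off h)

theorem dif_hat {B B' : Finset V} {f : AmbientChain V →ₗ[ℤ] AmbientChain V}
    (hf : ∀ y ∈ chainsOn (fun s => s ⊆ B), f y ∈ chainsOn (fun s => s ⊆ B'))
    (hd : ∀ y ∈ chainsOn (fun s => s ⊆ B), dif (f y) = f (dif y))
    {s : Finset V} (hs : Disjoint (s \ B) B') :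
    dif (hat B (fun _ => 1) f (face s)) = hat B (fun _ => 1) f (dif (face s)) := by
  have h : Disjoint (s \ B) B := Finset.sdiff_disjoint
  have hy : face (s ∩ B) ∈ chainsOn (fun s => s ⊆ B) :=
    face_mem_chainsOn Finset.inter_subset_right
  rw [face_eq_wedge B s]
  simp only [map_smul]
  rw [hat_wedge_face _ f h hy, one_smul, dif_wedge hs (hf _ hy), dif_wedge h hy, map_add,
    map_smul, hat_wedge_dif_one h f hy,
    hat_wedge_face _ f h (dif_mem (isComplex_subsets B) hy), one_smul, hd _ hy]

theorem dif_hat_add_hat_dif {B : Finset V} {H g : AmbientChain V →ₗ[ℤ] AmbientChain V}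
    (hH : ∀ y ∈ chainsOn (fun s => s ⊆ B), H y ∈ chainsOn (fun s => s ⊆ B))
    (hd : ∀ y ∈ chainsOn (fun s => s ⊆ B), dif (H y) + H (dif y) = g y) (x : AmbientChain V) :
    dif (hat B (fun t => (-1) ^ t.card) H x) + hat B (fun t => (-1) ^ t.card) H (dif x) =
      hat B (fun _ => 1) g x := by
  refine eq_of_face_eq
    (f := dif ∘ₗ hat B (fun t => (-1) ^ t.card) H + hat B (fun t => (-1) ^ t.card) H ∘ₗ dif)
    (fun s _ => ?_) (mem_chainsOn_univ x)
  have h : Disjoint (s \ B) B := Finset.sdiff_disjoint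
  have hy : face (s ∩ B) ∈ chainsOn (fun s => s ⊆ B) :=
    face_mem_chainsOn Finset.inter_subset_right
  simp only [LinearMap.add_apply, LinearMap.comp_apply]
  rw [face_eq_wedge B s]
  simp only [map_smul]
  have he : (-1 : ℤ) ^ (s \ B).card * (-1) ^ (s \ B).card = 1 := by rw [← mul_pow]; simp
  rw [← smul_add, hat_wedge_face _ H h hy, hat_wedge_face _ g h hy, one_smul, map_smul,
    dif_wedge h (hH _ hy), dif_wedge h hy, map_add, map_smul, hat_wedge H (dif_face_mem_off h) hy,
    hat_wedge_face _ H h (dif_mem (isComplex_subsets B) hy), ← hd _ hy, smul_add, smul_smul,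
    smul_smul, he, map_add]
  match_scalars <;> first | ring1 | linear_combination (shuffleSign (s \ B) (s ∩ B)) * he

theorem hat_hat {B B' : Finset V} {f g : AmbientChain V →ₗ[ℤ] AmbientChain V}
    (hf : ∀ y ∈ chainsOn (fun s => s ⊆ B), f y ∈ chainsOn (fun s => s ⊆ B'))
    {s : Finset V} (hs : Disjoint (s \ B) B') :
    hat B' (fun _ => 1) g (hat B (fun _ => 1) f (face s)) =
      hat B (fun _ => 1) (g ∘ₗ f) (face s) := by
  have hy : face (s ∩ B) ∈ chainsOn (fun s => s ⊆ B) :=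
    face_mem_chainsOn Finset.inter_subset_right
  rw [hat_face, map_smul, hat_wedge_face _ g hs (hf _ hy), hat_face, one_smul]
  rfl

theorem hat_face_mem {B : Finset V} {c : Finset V → ℤ}
    {f : AmbientChain V →ₗ[ℤ] AmbientChain V} {s : Finset V} {X Y : Set (Finset V)}
    (hf : f (face (s ∩ B)) ∈ chainsOn Y) (h : ∀ y ∈ Y, s \ B ∪ y ∈ X) :
    hat B c f (face s) ∈ chainsOn X := by
  rw [hat_face]
  refine Submodule.smul_mem _ _ (map_mem_of_face_mem (fun y hy => ?_) hf)
  rw [wedge_face_face]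
  exact Submodule.smul_mem _ _ (face_mem_chainsOn (h y hy))

/-! ### Sphere contractions and their transfer -/

/-- The chains of `X` admit a chain homotopy onto a single cycle `z` of degree `d`. -/
def HasSphereContraction (X : Set (Finset V)) (d : ℕ) : Prop :=
  ∃ (z : AmbientChain V) (r : AmbientChain V →ₗ[ℤ] ℤ) (h : AmbientChain V →ₗ[ℤ] AmbientChain V),
    z ∈ chainsOn {s | s ∈ X ∧ s.card = d} ∧ dif z = 0 ∧ r z = 1 ∧
      ∀ x ∈ chainsOn X,
        r (dif x) = 0 ∧ h x ∈ chainsOn X ∧ dif (h x) + h (dif x) = x - r x • z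

/-- The chain map `φ`, shifting degrees by `b`, embeds the chains of `X'` as a deformation
retract of the chains of `X`, with retraction `R` and homotopy `H`. -/
structure IsChainRetract {W : Type*} [LinearOrder W] (X : Set (Finset V)) (X' : Set (Finset W))
    (b : ℕ) (φ : AmbientChain W →ₗ[ℤ] AmbientChain V) (R : AmbientChain V →ₗ[ℤ] AmbientChain W)
    (H : AmbientChain V →ₗ[ℤ] AmbientChain V) : Prop where
  incl_mem : ∀ s ∈ X', φ (face s) ∈ chainsOn {t | t ∈ X ∧ t.card = s.card + b}
  retr_mem : ∀ s ∈ X, R (face s) ∈ chainsOn X'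
  htpy_mem : ∀ s ∈ X, H (face s) ∈ chainsOn X
  dif_incl : ∀ s ∈ X', dif (φ (face s)) = φ (dif (face s))
  dif_retr : ∀ s ∈ X, dif (R (face s)) = R (dif (face s))
  retr_incl : ∀ s ∈ X', R (φ (face s)) = face s
  htpy : ∀ s ∈ X, dif (H (face s)) + H (dif (face s)) = face s - φ (R (face s))

theorem chainsOn_mono {V : Type*} {X Y : Set (Finset V)} {x : AmbientChain V}
    (h : ∀ s ∈ X, s ∈ Y) (hx : x ∈ chainsOn X) : x ∈ chainsOn Y :=
  Finsupp.supported_mono h hx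

theorem HasSphereContraction.of_isChainRetract {W : Type*} [LinearOrder W]
    {X : Set (Finset V)} {X' : Set (Finset W)} {b d : ℕ}
    {φ : AmbientChain W →ₗ[ℤ] AmbientChain V} {R : AmbientChain V →ₗ[ℤ] AmbientChain W}
    {H : AmbientChain V →ₗ[ℤ] AmbientChain V} (hc : IsChainRetract X X' b φ R H)
    (h' : HasSphereContraction X' d) : HasSphereContraction X (d + b) := by
  obtain ⟨z, r, h, hz, hdz, hrz, hh⟩ := h'
  have hzX : z ∈ chainsOn X' := chainsOn_mono (fun _ hs => hs.1) hz
  have hφ : ∀ x ∈ chainsOn X', φ x ∈ chainsOn X := fun x hx =>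
    map_mem_of_face_mem (fun s hs => chainsOn_mono (fun _ ht => ht.1) (hc.incl_mem s hs)) hx
  have hdφ : ∀ x ∈ chainsOn X', dif (φ x) = φ (dif x) := fun x hx =>
    eq_of_face_eq (f := dif ∘ₗ φ) (g := φ ∘ₗ dif) hc.dif_incl hx
  have hdR : ∀ x ∈ chainsOn X, dif (R x) = R (dif x) := fun x hx =>
    eq_of_face_eq (f := dif ∘ₗ R) (g := R ∘ₗ dif) hc.dif_retr hx
  have hRφ : ∀ x ∈ chainsOn X', R (φ x) = x := fun x hx =>
    eq_of_face_eq (f := R ∘ₗ φ) (g := LinearMap.id) hc.retr_incl hx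
  have hH : ∀ x ∈ chainsOn X, dif (H x) + H (dif x) = x - φ (R x) := fun x hx =>
    eq_of_face_eq (f := dif ∘ₗ H + H ∘ₗ dif) (g := LinearMap.id - φ ∘ₗ R) hc.htpy hx
  refine ⟨φ z, r ∘ₗ R, H + φ ∘ₗ h ∘ₗ R, ?_, ?_, ?_, fun x hx => ?_⟩
  · refine map_mem_of_face_mem (fun s hs => ?_) hz
    refine chainsOn_mono (fun t ht => ⟨ht.1, by rw [ht.2, hs.2]⟩) (hc.incl_mem s hs.1)
  · rw [hdφ z hzX, hdz, map_zero]
  · rw [LinearMap.comp_apply, hRφ z hzX, hrz]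
  · have hRx : R x ∈ chainsOn X' := map_mem_of_face_mem hc.retr_mem hx
    obtain ⟨h1, h2, h3⟩ := hh _ hRx
    refine ⟨?_, ?_, ?_⟩
    · rw [LinearMap.comp_apply, ← hdR x hx, h1]
    · exact Submodule.add_mem _ (map_mem_of_face_mem hc.htpy_mem hx) (hφ _ h2)
    · simp only [LinearMap.add_apply, LinearMap.comp_apply, map_add]
      rw [hdφ _ h2, ← hdR x hx]
      have e1 := hH x hx
      have e2 := congrArg φ h3
      simp only [map_add, map_sub, map_smul] at e2
      rw [add_add_add_comm, e1, e2]
      abel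

/-- The complex obtained from `Q` by joining `P ⊆ Q` with the full simplex on the block `B`
and the rest of `Q` with `L`. -/
def blockJoin (B : Finset V) (L P Q : Set (Finset V)) : Set (Finset V) :=
  {s | s \ B ∈ Q ∧ (s ∩ B ∈ L ∨ s \ B ∈ P)}

theorem union_mem_blockJoin {B : Finset V} {L P Q : Set (Finset V)} {t y : Finset V}
    (ht : t ∈ Q) (hd : Disjoint t B) (hy : y ⊆ B) (h : y ∈ L ∨ t ∈ P) :
    t ∪ y ∈ blockJoin B L P Q := by
  have h1 : (t ∪ y) \ B = t := by
    rw [Finset.union_sdiff_distrib, Finset.sdiff_eq_self_of_disjoint hd,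
      Finset.sdiff_eq_empty_iff_subset.2 hy, Finset.union_empty]
  have h2 : (t ∪ y) ∩ B = y := by
    rw [Finset.union_inter_distrib_right, Finset.disjoint_iff_inter_eq_empty.1 hd,
      Finset.inter_eq_left.2 hy, Finset.empty_union]
  refine ⟨?_, ?_⟩
  · rwa [h1]
  · rwa [h1, h2]

/-- A deformation retract of pairs `(2^B, L) → (2^B', L')` extends to block joins. -/
theorem IsChainRetract.blockJoin {B B' : Finset V} {L L' P Q : Set (Finset V)} {b : ℕ}
    {φ R H : AmbientChain V →ₗ[ℤ] AmbientChain V}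
    (hB : IsChainRetract (fun s => s ⊆ B) (fun s => s ⊆ B') b φ R H)
    (hL : IsChainRetract L L' b φ R H) (hLB : ∀ s ∈ L, s ⊆ B) (hLB' : ∀ s ∈ L', s ⊆ B')
    (hQ : ∀ t ∈ Q, Disjoint t B) (hQ' : ∀ t ∈ Q, Disjoint t B') :
    IsChainRetract (blockJoin B L P Q) (blockJoin B' L' P Q) b
      (hat B' (fun _ => 1) φ) (hat B (fun _ => 1) R) (hat B (fun t => (-1) ^ t.card) H) := by
  have hφ : ∀ y ∈ chainsOn (fun s => s ⊆ B'), φ y ∈ chainsOn (fun s => s ⊆ B) := fun x hx =>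
    map_mem_of_face_mem (fun s hs => chainsOn_mono (fun _ ht => ht.1) (hB.incl_mem s hs)) hx
  have hR : ∀ y ∈ chainsOn (fun s => s ⊆ B), R y ∈ chainsOn (fun s => s ⊆ B') := fun x hx =>
    map_mem_of_face_mem hB.retr_mem hx
  have hH : ∀ y ∈ chainsOn (fun s => s ⊆ B), H y ∈ chainsOn (fun s => s ⊆ B) := fun x hx =>
    map_mem_of_face_mem hB.htpy_mem hx
  refine ⟨?_, ?_, ?_, ?_, ?_, ?_, ?_⟩
  · rintro s ⟨hsQ, hs⟩
    have hcard : s.card = (s \ B').card + (s ∩ B').card := (Finset.card_sdiff_add_card_inter s B').symm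
    have key : φ (face (s ∩ B')) ∈
        chainsOn {y | (y ⊆ B ∧ (y ∈ L ∨ s \ B' ∈ P)) ∧ y.card = (s ∩ B').card + b} := by
      rcases hs with hs | hs
      · refine chainsOn_mono (fun y hy => ⟨⟨hLB y hy.1, Or.inl hy.1⟩, hy.2⟩) (hL.incl_mem _ hs)
      · refine chainsOn_mono (fun y hy => ⟨⟨hy.1, Or.inr hs⟩, hy.2⟩)
          (hB.incl_mem _ Finset.inter_subset_right)
    refine hat_face_mem key fun y hy => ⟨union_mem_blockJoin hsQ (hQ _ hsQ) hy.1.1 hy.1.2, ?_⟩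
    rw [Finset.card_union_of_disjoint ((hQ _ hsQ).mono_right hy.1.1), hy.2, hcard, add_assoc]
  · rintro s ⟨hsQ, hs⟩
    have key : R (face (s ∩ B)) ∈ chainsOn {y | y ⊆ B' ∧ (y ∈ L' ∨ s \ B ∈ P)} := by
      rcases hs with hs | hs
      · refine chainsOn_mono (fun y hy => ⟨hLB' y hy, Or.inl hy⟩) (hL.retr_mem _ hs)
      · refine chainsOn_mono (fun y hy => ⟨hy, Or.inr hs⟩)
          (hB.retr_mem _ Finset.inter_subset_right)
    exact hat_face_mem key fun y hy => union_mem_blockJoin hsQ (hQ' _ hsQ) hy.1 hy.2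
  · rintro s ⟨hsQ, hs⟩
    have key : H (face (s ∩ B)) ∈ chainsOn {y | y ⊆ B ∧ (y ∈ L ∨ s \ B ∈ P)} := by
      rcases hs with hs | hs
      · refine chainsOn_mono (fun y hy => ⟨hLB y hy, Or.inl hy⟩) (hL.htpy_mem _ hs)
      · refine chainsOn_mono (fun y hy => ⟨hy, Or.inr hs⟩)
          (hB.htpy_mem _ Finset.inter_subset_right)
    exact hat_face_mem key fun y hy => union_mem_blockJoin hsQ (hQ _ hsQ) hy.1 hy.2
  · rintro s ⟨hsQ, -⟩
    exact dif_hat hφ (fun y hy => eq_of_face_eq (f := dif ∘ₗ φ) (g := φ ∘ₗ dif) hB.dif_incl hy)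
      (hQ _ hsQ)
  · rintro s ⟨hsQ, -⟩
    exact dif_hat hR (fun y hy => eq_of_face_eq (f := dif ∘ₗ R) (g := R ∘ₗ dif) hB.dif_retr hy)
      (hQ' _ hsQ)
  · rintro s ⟨hsQ, -⟩
    rw [hat_hat hφ (hQ _ hsQ), hat_face, LinearMap.comp_apply,
      hB.retr_incl _ Finset.inter_subset_right, mul_one, ← face_eq_wedge]
  · rintro s ⟨hsQ, -⟩
    rw [dif_hat_add_hat_dif (g := LinearMap.id - φ ∘ₗ R) hH
      (fun y hy => eq_of_face_eq (f := dif ∘ₗ H + H ∘ₗ dif) (g := LinearMap.id - φ ∘ₗ R)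
        hB.htpy hy), hat_hat hR (hQ' _ hsQ), hat_face, hat_face, LinearMap.sub_apply, map_sub,
      smul_sub, LinearMap.id_apply, mul_one, ← face_eq_wedge]

/-! ### The local retraction of a full simplex relative to a sphere -/

theorem exists_cone_contraction {B : Finset V} (hB : B.Nonempty) :
    ∃ κ : AmbientChain V →ₗ[ℤ] AmbientChain V, (∀ x, dif (κ x) + κ (dif x) = x) ∧
      (∀ s ⊆ B, κ (face s) ∈ chainsOn {t | t ⊆ B ∧ t.card = s.card + 1}) := by
  obtain ⟨v, hv⟩ := hB
  let k : AmbientChain V →ₗ[ℤ] AmbientChain V :=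
    onFaces fun s => if s = ∅ then face {v} else 0
  have hk0 : k (face ∅) = face {v} := by simp only [k, onFaces_face, if_true]
  have hk1 : k (face {v}) = 0 := by
    simp only [k, onFaces_face, Finset.singleton_ne_empty, if_false]
  have hk : ∀ s ⊆ {v}, k (face s) ∈ chainsOn (fun s => s ⊆ {v}) ∧
      dif (k (face s)) + k (dif (face s)) = face s := by
    intro s hs
    rcases Finset.subset_singleton_iff.1 hs with rfl | rfl
    · rw [hk0, dif_face_singleton, dif_face_empty, map_zero, add_zero]
      exact ⟨face_mem_chainsOn (Finset.Subset.refl _), rfl⟩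
    · rw [hk1, dif_face_singleton, hk0, map_zero, zero_add]
      exact ⟨Submodule.zero_mem _, rfl⟩
  refine ⟨hat {v} (fun t => (-1) ^ t.card) k, fun x => ?_, fun s hs => ?_⟩
  · rw [dif_hat_add_hat_dif (g := LinearMap.id)
      (fun y hy => map_mem_of_face_mem (fun s hs => (hk s hs).1) hy)
      (fun y hy => eq_of_face_eq (f := dif ∘ₗ k + k ∘ₗ dif) (g := LinearMap.id)
        (fun s hs => (hk s hs).2) hy), hat_id]
  · have hcard := Finset.card_sdiff_add_card_inter s {v}
    have hd : Disjoint (s \ {v}) {v} := Finset.sdiff_disjoint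
    rcases Finset.subset_singleton_iff.1 (Finset.inter_subset_right : s ∩ {v} ⊆ {v}) with h | h
    · refine hat_face_mem (Y := {{v}}) ?_ ?_
      · rw [h, hk0]; exact face_mem_chainsOn rfl
      · rintro _ rfl
        refine ⟨Finset.union_subset (Finset.sdiff_subset.trans hs)
          (Finset.singleton_subset_iff.2 hv), ?_⟩
        rw [Finset.card_union_of_disjoint hd, Finset.card_singleton, ← hcard, h,
          Finset.card_empty, add_zero]
    · refine hat_face_mem (Y := ∅) ?_ (by simp)
      rw [h, hk1]; exact Submodule.zero_mem _

/-- The projection onto the chains supported on `X`. -/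
noncomputable def chainProj {V : Type*} (X : Set (Finset V)) :
    AmbientChain V →ₗ[ℤ] AmbientChain V :=
  open Classical in onFaces fun s => if s ∈ X then face s else 0

theorem chainProj_face {V : Type*} {X : Set (Finset V)} {s : Finset V} (h : s ∈ X) :
    chainProj X (face s) = face s := by
  simp only [chainProj, onFaces_face, if_pos h]

theorem chainProj_face_of_notMem {V : Type*} {X : Set (Finset V)} {s : Finset V} (h : s ∉ X) :
    chainProj X (face s) = 0 := by
  simp only [chainProj, onFaces_face, if_neg h]

theorem chainProj_of_mem {V : Type*} {X : Set (Finset V)} {x : AmbientChain V}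
    (h : x ∈ chainsOn X) : chainProj X x = x :=
  eq_of_face_eq (g := LinearMap.id) (fun _ hs => chainProj_face hs) h

theorem chainProj_mem {V : Type*} {X Y : Set (Finset V)} {x : AmbientChain V}
    (hx : x ∈ chainsOn Y) : chainProj X x ∈ chainsOn (Y ∩ X) := by
  refine map_mem_of_face_mem (fun s hs => ?_) hx
  by_cases h : s ∈ X
  · rw [chainProj_face h]; exact face_mem_chainsOn ⟨hs, h⟩
  · rw [chainProj_face_of_notMem h]; exact Submodule.zero_mem _

theorem HasSphereContraction.exists_isChainRetract {B : Finset V} (hB : B.Nonempty)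
    {L : Set (Finset V)} (hL : IsComplex L) (hLB : ∀ s ∈ L, s ⊆ B) {b : ℕ}
    (h : HasSphereContraction L b) (v : V) :
    ∃ φ R H : AmbientChain V →ₗ[ℤ] AmbientChain V,
      IsChainRetract (fun s => s ⊆ B) (fun s => s ⊆ {v}) b φ R H ∧
        IsChainRetract L {∅} b φ R H := by
  obtain ⟨z, r, h, hz, hdz, hrz, hh⟩ := h
  obtain ⟨κ, hκ, hκmem⟩ := exists_cone_contraction hB
  have hzL : z ∈ chainsOn L := chainsOn_mono (fun _ hs => hs.1) hz
  have hLB' : ∀ x ∈ chainsOn L, x ∈ chainsOn (fun s => s ⊆ B) := fun x hx => chainsOn_mono hLB hx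
  have hκB : ∀ x ∈ chainsOn (fun s => s ⊆ B), κ x ∈ chainsOn (fun s => s ⊆ B) := fun x hx =>
    map_mem_of_face_mem (fun s hs => chainsOn_mono (fun _ ht => ht.1) (hκmem s hs)) hx
  set w := κ z with hw
  have hdw : dif w = z := by
    have := hκ z
    rwa [hdz, map_zero, add_zero] at this
  have hwmem : w ∈ chainsOn {t | t ⊆ B ∧ t.card = b + 1} :=
    map_mem_of_face_mem (fun s hs => by
      have := hκmem s (hLB s hs.1)
      rwa [hs.2] at this) hz
  have hpmem : ∀ x, chainProj L x ∈ chainsOn L := fun x =>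
    chainsOn_mono (fun _ hs => hs.2) (chainProj_mem (X := L) (mem_chainsOn_univ x))
  have hpL : ∀ x ∈ chainsOn L, chainProj L x = x := fun x hx => chainProj_of_mem hx
  let φ : AmbientChain V →ₗ[ℤ] AmbientChain V := onFaces fun s => if s = ∅ then z else w
  have hφ0 : φ (face ∅) = z := by simp only [φ, onFaces_face, if_true]
  have hφ1 : φ (face {v}) = w := by
    simp only [φ, onFaces_face, Finset.singleton_ne_empty, if_false]
  -- the coefficient of `z`, corrected so that it vanishes on `w`
  let q : AmbientChain V →ₗ[ℤ] ℤ := r ∘ₗ chainProj L - r (chainProj L w) • r ∘ₗ chainProj L ∘ₗ dif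
  have hq : ∀ x, q x = r (chainProj L x) - r (chainProj L w) * r (chainProj L (dif x)) :=
    fun _ => rfl
  have hqL : ∀ x ∈ chainsOn L, q x = r x := fun x hx => by
    rw [hq, hpL x hx, hpL _ (dif_mem hL hx), (hh x hx).1, mul_zero, sub_zero]
  have hqz : q z = 1 := by rw [hqL z hzL, hrz]
  have hqw : q w = 0 := by rw [hq, hdw, hpL z hzL, hrz, mul_one, sub_self]
  let R : AmbientChain V →ₗ[ℤ] AmbientChain V :=
    q.smulRight (face ∅) + (q ∘ₗ dif).smulRight (face {v})
  have hR : ∀ x, R x = q x • face ∅ + q (dif x) • face {v} := fun _ => rfl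
  have hRL : ∀ x ∈ chainsOn L, R x = r x • face ∅ := fun x hx => by
    rw [hR, hqL x hx, hqL _ (dif_mem hL hx), (hh x hx).1, zero_smul, add_zero]
  have hdR : ∀ x, dif (R x) = R (dif x) := fun x => by
    rw [hR, hR, map_add, map_smul, map_smul, dif_face_empty, dif_face_singleton, dif_dif,
      map_zero, smul_zero, zero_smul, zero_add, add_zero]
  have hφR : ∀ x, φ (R x) = q x • z + q (dif x) • w := fun x => by
    rw [hR, map_add, map_smul, map_smul, hφ0, hφ1]
  have hdφR : ∀ x, dif (φ (R x)) = φ (R (dif x)) := fun x => by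
    rw [hφR, hφR, map_add, map_smul, map_smul, hdz, hdw, dif_dif, map_zero, zero_smul, smul_zero,
      zero_add, add_zero]
  let k : AmbientChain V →ₗ[ℤ] AmbientChain V := h ∘ₗ chainProj L
  have hkmem : ∀ x, k x ∈ chainsOn L := fun x => (hh _ (hpmem x)).2.1
  have hkL : ∀ x ∈ chainsOn L, dif (k x) + k (dif x) = x - φ (R x) := fun x hx => by
    have : dif (h x) + h (dif x) = x - r x • z := (hh x hx).2.2
    simp only [k, LinearMap.comp_apply]
    rw [hpL x hx, hpL _ (dif_mem hL hx), this, hRL x hx, map_smul, hφ0]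
  let e : AmbientChain V →ₗ[ℤ] AmbientChain V :=
    LinearMap.id - φ ∘ₗ R - (dif ∘ₗ k + k ∘ₗ dif)
  have he : ∀ x, e x = x - φ (R x) - (dif (k x) + k (dif x)) := fun _ => rfl
  have heL : ∀ x ∈ chainsOn L, e x = 0 := fun x hx => by rw [he, hkL x hx, sub_self]
  have hed : ∀ x, dif (e x) = e (dif x) := fun x => by
    rw [he, he, map_sub, map_sub, map_add, hdφR, dif_dif, dif_dif, map_zero, zero_add, add_zero]
  have hRB : ∀ x, R x ∈ chainsOn (fun s => s ⊆ {v}) := fun x => by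
    rw [hR]
    exact Submodule.add_mem _
      (Submodule.smul_mem _ _ (face_mem_chainsOn (Finset.empty_subset _)))
      (Submodule.smul_mem _ _ (face_mem_chainsOn (Finset.Subset.refl _)))
  have heB : ∀ x ∈ chainsOn (fun s => s ⊆ B), e x ∈ chainsOn (fun s => s ⊆ B) := fun x hx => by
    rw [he, hφR]
    refine Submodule.sub_mem _ (Submodule.sub_mem _ hx (Submodule.add_mem _ ?_ ?_))
      (Submodule.add_mem _ ?_ ?_)
    · exact Submodule.smul_mem _ _ (hLB' z hzL)
    · exact Submodule.smul_mem _ _ (chainsOn_mono (fun _ ht => ht.1) hwmem)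
    · exact hLB' _ (dif_mem hL (hkmem x))
    · exact hLB' _ (hkmem _)
  have hH : ∀ x, dif ((k + κ ∘ₗ e) x) + (k + κ ∘ₗ e) (dif x) = x - φ (R x) := fun x => by
    simp only [LinearMap.add_apply, LinearMap.comp_apply, map_add]
    have h1 := hκ (e x)
    rw [hed] at h1
    rw [add_add_add_comm, h1, he]
    abel
  refine ⟨φ, R, k + κ ∘ₗ e, ⟨?_, ?_, ?_, ?_, fun s _ => hdR _, ?_, fun s _ => hH _⟩,
    ⟨?_, ?_, ?_, ?_, fun s _ => hdR _, ?_, fun s _ => hH _⟩⟩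
  · intro s hs
    rcases Finset.subset_singleton_iff.1 hs with rfl | rfl
    · rw [hφ0]
      refine chainsOn_mono (fun t ht => ⟨hLB t ht.1, by simp [ht.2]⟩) hz
    · rw [hφ1]
      refine chainsOn_mono (fun t ht => ⟨ht.1, by rw [ht.2, Finset.card_singleton, add_comm]⟩) hwmem
  · exact fun s _ => hRB _
  · intro s hs
    exact Submodule.add_mem _ (hLB' _ (hkmem _)) (hκB _ (heB _ (face_mem_chainsOn hs)))
  · intro s hs
    rcases Finset.subset_singleton_iff.1 hs with rfl | rfl
    · rw [hφ0, dif_face_empty, map_zero, hdz]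
    · rw [hφ1, dif_face_singleton, hφ0, hdw]
  · intro s hs
    rcases Finset.subset_singleton_iff.1 hs with rfl | rfl
    · rw [hφ0, hR, hqz, hdz, map_zero, zero_smul, one_smul, add_zero]
    · rw [hφ1, hR, hqw, hdw, hqz, zero_smul, one_smul, zero_add]
  · rintro _ rfl
    rw [hφ0]
    refine chainsOn_mono (fun t ht => ⟨ht.1, by simp [ht.2]⟩) hz
  · intro s hs
    rw [hRL _ (face_mem_chainsOn hs)]
    exact Submodule.smul_mem _ _ (face_mem_chainsOn rfl)
  · intro s hs
    have hk : (k + κ ∘ₗ e) (face s) = k (face s) + κ (e (face s)) := rfl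
    rw [hk, heL _ (face_mem_chainsOn hs), map_zero,
      add_zero]
    exact hkmem _
  · rintro _ rfl
    rw [hφ0, dif_face_empty, map_zero, hdz]
  · rintro _ rfl
    rw [hφ0, hR, hqz, hdz, map_zero, zero_smul, one_smul, add_zero]

theorem HasSphereContraction.blockJoin {B : Finset V} (hB : B.Nonempty)
    {L P Q : Set (Finset V)} (hL : IsComplex L) (hLB : ∀ s ∈ L, s ⊆ B) {b d : ℕ} {v : V}
    (hQ : ∀ t ∈ Q, Disjoint t B) (hv : ∀ t ∈ Q, v ∉ t) (h : HasSphereContraction L b)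
    (h' : HasSphereContraction (blockJoin {v} {∅} P Q) d) :
    HasSphereContraction (blockJoin B L P Q) (d + b) := by
  obtain ⟨φ, R, H, h1, h2⟩ := h.exists_isChainRetract hB hL hLB v
  exact .of_isChainRetract (h1.blockJoin h2 hLB (by simp) hQ
    fun t ht => Finset.disjoint_singleton_right.2 (hv t ht)) h'

/-- Sphere contractions are transported along order embeddings of the vertices. -/
theorem HasSphereContraction.map {W : Type*} [LinearOrder W] {X : Set (Finset V)} {d : ℕ}
    (f : V ↪o W) (h : HasSphereContraction X d) :
    HasSphereContraction {s | ∃ t ∈ X, t.map f.toEmbedding = s} d := by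
  let φ : AmbientChain V →ₗ[ℤ] AmbientChain W := onFaces fun s => face (s.map f.toEmbedding)
  let R : AmbientChain W →ₗ[ℤ] AmbientChain V :=
    onFaces fun s => face (s.preimage f f.injective.injOn)
  have hφ : ∀ s, φ (face s) = face (s.map f.toEmbedding) := fun s => onFaces_face _ s
  have hR : ∀ s, R (face s) = face (s.preimage f f.injective.injOn) := fun s => onFaces_face _ s
  have hRφ : ∀ s, R (φ (face s)) = face s := fun s => by
    rw [hφ, hR]
    congr 1
    ext; simp
  have hdφ : ∀ s, dif (φ (face s)) = φ (dif (face s)) := fun s => by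
    rw [hφ, dif_face, dif_face, map_sum, Finset.sum_map]
    refine Finset.sum_congr rfl fun i _ => ?_
    rw [map_smul, hφ, Finset.map_erase]
    congr 1
    simp [passSign]
  refine HasSphereContraction.of_isChainRetract (b := 0) (φ := φ) (R := R) (H := 0)
    ⟨?_, ?_, ?_, fun s _ => hdφ s, ?_, fun s _ => hRφ s, ?_⟩ h
  · intro s hs
    rw [hφ]
    exact face_mem_chainsOn ⟨⟨s, hs, rfl⟩, by simp⟩
  · rintro _ ⟨t, ht, rfl⟩
    rw [← hφ, hRφ]
    exact face_mem_chainsOn ht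
  · intro s _
    exact Submodule.zero_mem _
  · rintro _ ⟨t, ht, rfl⟩
    rw [← hφ, hRφ, hdφ]
    exact (eq_of_face_eq (f := R ∘ₗ φ) (g := LinearMap.id) (fun s _ => hRφ s)
      (mem_chainsOn_univ _)).symm
  · rintro _ ⟨t, ht, rfl⟩
    rw [← hφ, hRφ]
    simp

/-! ### Comparison with reduced homology -/

theorem chainProj_card_succ_dif_face (n : ℕ) (s : Finset V) :
    dif (chainProj {s | s.card = n + 1} (face s)) = chainProj {s | s.card = n} (dif (face s)) := by
  have hcard : ∀ i ∈ s, (s.erase i).card + 1 = s.card := fun i hi => Finset.card_erase_add_one hi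
  by_cases h : s.card = n + 1
  · rw [chainProj_face (X := {s : Finset V | s.card = n + 1}) h, dif_face, map_sum]
    refine Finset.sum_congr rfl fun i hi => ?_
    have hc := hcard i hi
    have hn : (s.erase i).card = n := by omega
    rw [map_smul, chainProj_face (X := {s : Finset V | s.card = n}) hn]
  · rw [chainProj_face_of_notMem (X := {s : Finset V | s.card = n + 1}) h, dif_face, map_sum,
      map_zero]
    refine (Finset.sum_eq_zero fun i hi => ?_).symm
    have hc := hcard i hi
    have hn : (s.erase i).card ≠ n := by omega
    rw [map_smul, chainProj_face_of_notMem (X := {s : Finset V | s.card = n}) hn, smul_zero]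

theorem chainProj_card_succ_dif (n : ℕ) (x : AmbientChain V) :
    dif (chainProj {s | s.card = n + 1} x) = chainProj {s | s.card = n} (dif x) := by
  have h : (dif ∘ₗ chainProj {s | s.card = n + 1} : AmbientChain V →ₗ[ℤ] AmbientChain V) =
      chainProj {s | s.card = n} ∘ₗ dif :=
    Finsupp.lhom_ext' fun s => LinearMap.ext_ring (chainProj_card_succ_dif_face n s)
  exact LinearMap.congr_fun h x

theorem chainProj_card_mem {V : Type*} {X : Set (Finset V)} {x : AmbientChain V} (hx : x ∈ chainsOn X)
    (n : ℕ) : chainProj {s | s.card = n} x ∈ chainsOn {s | s ∈ X ∧ s.card = n} :=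
  chainProj_mem hx

theorem chainProj_card_of_mem {V : Type*} {X : Set (Finset V)} {x : AmbientChain V} {n : ℕ}
    (hx : x ∈ chainsOn {s | s ∈ X ∧ s.card = n}) : chainProj {s | s.card = n} x = x :=
  chainProj_of_mem (chainsOn_mono (fun _ hs => hs.2) hx)

theorem chainProj_card_of_mem_of_ne {V : Type*} {X : Set (Finset V)} {x : AmbientChain V} {n d : ℕ}
    (hx : x ∈ chainsOn {s | s ∈ X ∧ s.card = d}) (h : n ≠ d) :
    chainProj {s | s.card = n} x = 0 :=
  (Submodule.mem_bot ℤ).1 (map_mem_of_face_mem (fun s hs => by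
    rw [Submodule.mem_bot]
    refine chainProj_face_of_notMem (X := {s : Finset V | s.card = n}) fun hn => h ?_
    exact hn.symm.trans hs.2) hx)

theorem exists_sum_chainProj_card {V : Type*} (x : AmbientChain V) :
    ∃ N : ℕ, x = ∑ n ∈ Finset.range N, chainProj {s | s.card = n} x := by
  refine ⟨x.support.sup Finset.card + 1, ?_⟩
  have hx : x ∈ chainsOn {s | s.card < x.support.sup Finset.card + 1} := fun s hs =>
    Nat.lt_succ_of_le (Finset.le_sup (f := Finset.card) hs)
  generalize x.support.sup Finset.card + 1 = N at hx
  have := eq_of_face_eq (f := LinearMap.id)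
    (g := ∑ n ∈ Finset.range N, chainProj {s | s.card = n}) (fun s hs => ?_) hx
  · simpa using this
  · rw [LinearMap.sum_apply, Finset.sum_eq_single s.card]
    · exact (chainProj_face (X := {t : Finset V | t.card = s.card}) rfl).symm
    · intro n _ hn
      exact chainProj_face_of_notMem (X := {t : Finset V | t.card = n}) fun h => hn h.symm
    · intro h
      exact absurd (Finset.mem_range.2 hs) h

/-- The inclusion of the degree `n` chains of `X` into the ambient chains. -/
noncomputable def toAmbient {V : Type*} (X : Set (Finset V)) (n : ℕ) :
    chainsOf X n →ₗ[ℤ] AmbientChain V :=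
  Finsupp.lmapDomain ℤ ℤ Subtype.val

theorem toAmbient_single {V : Type*} (X : Set (Finset V)) (n : ℕ)
    (s : {s : Finset V // s ∈ X ∧ s.card = n}) :
    toAmbient X n (Finsupp.single s 1) = face s.1 := by
  simp [toAmbient, face]

theorem toAmbient_injective {V : Type*} (X : Set (Finset V)) (n : ℕ) :
    Function.Injective (toAmbient X n) :=
  Finsupp.mapDomain_injective Subtype.val_injective

theorem range_toAmbient {V : Type*} (X : Set (Finset V)) (n : ℕ) :
    LinearMap.range (toAmbient X n) = chainsOn {s | s ∈ X ∧ s.card = n} := by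
  rw [toAmbient, Finsupp.range_lmapDomain, chainsOn_eq_span]
  congr 1
  ext x
  simp [face]

theorem toAmbient_mem {V : Type*} {X : Set (Finset V)} {n : ℕ} (x : chainsOf X n) :
    toAmbient X n x ∈ chainsOn {s | s ∈ X ∧ s.card = n} := by
  rw [← range_toAmbient]
  exact LinearMap.mem_range_self _ x

theorem exists_toAmbient_eq {V : Type*} {X : Set (Finset V)} {n : ℕ} {x : AmbientChain V}
    (hx : x ∈ chainsOn {s | s ∈ X ∧ s.card = n}) : ∃ y, toAmbient X n y = x := by
  rwa [← range_toAmbient] at hx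

theorem toAmbient_bdry {X : Set (Finset V)} (hX : IsComplex X) (n : ℕ)
    (x : chainsOf X (n + 1)) : toAmbient X n (bdry X n x) = dif (toAmbient X (n + 1) x) := by
  have : toAmbient X n ∘ₗ bdry X n = dif ∘ₗ toAmbient X (n + 1) := by
    refine Finsupp.lhom_ext' fun s => LinearMap.ext_ring ?_
    simp only [LinearMap.comp_apply, Finsupp.lsingle_apply]
    rw [toAmbient_single, dif_face, bdry, Finsupp.lsum_single, LinearMap.sum_apply, map_sum,
      ← Finset.sum_attach s.1]
    refine Finset.sum_congr rfl fun i _ => ?_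
    rw [dif_pos (hX s.1 s.2.1 _ (Finset.erase_subset _ _)), LinearMap.smul_apply, map_smul,
      Finsupp.lsingle_apply, toAmbient_single, passSign_eq]
  exact LinearMap.congr_fun this x

theorem mem_cyc_iff {X : Set (Finset V)} (hX : IsComplex X) {n : ℕ} (x : chainsOf X n) :
    x ∈ cyc X n ↔ dif (toAmbient X n x) = 0 := by
  cases n with
  | zero =>
    refine ⟨fun _ => (Submodule.mem_bot ℤ).1 (map_mem_of_face_mem (fun s hs => ?_)
      (toAmbient_mem x)), fun _ => Submodule.mem_top⟩
    rw [Finset.card_eq_zero.1 hs.2, dif_face_empty]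
    exact Submodule.zero_mem _
  | succ n =>
    rw [cyc, LinearMap.mem_ker, ← toAmbient_bdry hX, map_eq_zero_iff _ (toAmbient_injective X n)]

theorem Hgrp_mk_eq_zero_iff {X : Set (Finset V)} (hX : IsComplex X) {n : ℕ} (x : cyc X n) :
    (Submodule.Quotient.mk x : Hgrp X n) = 0 ↔
      ∃ y ∈ chainsOn {s | s ∈ X ∧ s.card = n + 1}, dif y = toAmbient X n x.1 := by
  rw [Submodule.Quotient.mk_eq_zero, Submodule.mem_comap, LinearMap.mem_range]
  constructor
  · rintro ⟨y, hy⟩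
    refine ⟨_, toAmbient_mem y, ?_⟩
    rw [← toAmbient_bdry hX, hy]
    rfl
  · rintro ⟨y, hy, h⟩
    obtain ⟨y, rfl⟩ := exists_toAmbient_eq hy
    refine ⟨y, toAmbient_injective X n ?_⟩
    rw [toAmbient_bdry hX, h]
    rfl

theorem subsingleton_Hgrp_iff {X : Set (Finset V)} (hX : IsComplex X) (n : ℕ) :
    Subsingleton (Hgrp X n) ↔ ∀ c ∈ chainsOn {s | s ∈ X ∧ s.card = n}, dif c = 0 →
      ∃ y ∈ chainsOn {s | s ∈ X ∧ s.card = n + 1}, dif y = c := by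
  constructor
  · intro _ c hc hdc
    obtain ⟨x, rfl⟩ := exists_toAmbient_eq hc
    exact (Hgrp_mk_eq_zero_iff hX ⟨x, (mem_cyc_iff hX x).2 hdc⟩).1 (Subsingleton.elim _ _)
  · intro h
    refine subsingleton_of_forall_eq 0 fun q => ?_
    obtain ⟨x, rfl⟩ := Submodule.Quotient.mk_surjective _ q
    exact (Hgrp_mk_eq_zero_iff hX x).2 (h _ (toAmbient_mem _) ((mem_cyc_iff hX _).1 x.2))

theorem nonempty_Hgrp_equiv_iff {X : Set (Finset V)} (hX : IsComplex X) (n : ℕ) :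
    Nonempty (Hgrp X n ≃ₗ[ℤ] ℤ) ↔ ∃ z ∈ chainsOn {s | s ∈ X ∧ s.card = n}, dif z = 0 ∧
      (∀ c ∈ chainsOn {s | s ∈ X ∧ s.card = n}, dif c = 0 →
        ∃ k : ℤ, ∃ y ∈ chainsOn {s | s ∈ X ∧ s.card = n + 1}, dif y = c - k • z) ∧
      ∀ k : ℤ, ∀ y ∈ chainsOn {s | s ∈ X ∧ s.card = n + 1}, dif y = k • z → k = 0 := by
  constructor
  · rintro ⟨e⟩
    obtain ⟨z, hz⟩ := Submodule.Quotient.mk_surjective _ (e.symm 1)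
    have hez : e (Submodule.Quotient.mk z) = 1 := by rw [hz, e.apply_symm_apply]
    refine ⟨toAmbient X n z.1, toAmbient_mem _, (mem_cyc_iff hX _).1 z.2, fun c hc hdc => ?_,
      fun k y hy h => ?_⟩
    · obtain ⟨x, rfl⟩ := exists_toAmbient_eq hc
      let x' : cyc X n := ⟨x, (mem_cyc_iff hX x).2 hdc⟩
      let k : ℤ := e (Submodule.Quotient.mk x')
      have h0 : (Submodule.Quotient.mk (x' - k • z) : Hgrp X n) = 0 := by
        apply e.injective
        rw [Submodule.Quotient.mk_sub, Submodule.Quotient.mk_smul, map_sub, map_smul, hez,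
          map_zero]
        simp [k]
      obtain ⟨y, hy, h⟩ := (Hgrp_mk_eq_zero_iff hX _).1 h0
      refine ⟨k, y, hy, h.trans ?_⟩
      rw [← map_smul, ← map_sub]
      rfl
    · have h0 : (Submodule.Quotient.mk (k • z) : Hgrp X n) = 0 :=
        (Hgrp_mk_eq_zero_iff hX _).2 ⟨y, hy, h.trans (map_smul _ _ _).symm⟩
      have := congrArg e h0
      rw [Submodule.Quotient.mk_smul, map_smul, hez, map_zero] at this
      simpa using this
  · rintro ⟨z, hz, hdz, hsurj, hinj⟩
    obtain ⟨x, rfl⟩ := exists_toAmbient_eq hz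
    let z' : cyc X n := ⟨x, (mem_cyc_iff hX x).2 hdz⟩
    refine ⟨(LinearEquiv.ofBijective
      (LinearMap.toSpanSingleton ℤ (Hgrp X n) (Submodule.Quotient.mk z')) ⟨?_, ?_⟩).symm⟩
    · rw [injective_iff_map_eq_zero]
      intro k hk
      rw [LinearMap.toSpanSingleton_apply, ← Submodule.Quotient.mk_smul] at hk
      obtain ⟨y, hy, h⟩ := (Hgrp_mk_eq_zero_iff hX _).1 hk
      exact hinj k y hy (h.trans (map_smul (toAmbient X n) k x))
    · intro q
      obtain ⟨c, rfl⟩ := Submodule.Quotient.mk_surjective _ q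
      obtain ⟨k, y, hy, h⟩ := hsurj _ (toAmbient_mem c.1) ((mem_cyc_iff hX _).1 c.2)
      refine ⟨k, ?_⟩
      rw [LinearMap.toSpanSingleton_apply, ← Submodule.Quotient.mk_smul, eq_comm, ← sub_eq_zero,
        ← Submodule.Quotient.mk_sub]
      refine (Hgrp_mk_eq_zero_iff hX _).2 ⟨y, hy, h.trans ?_⟩
      rw [← map_smul, ← map_sub]
      rfl

theorem HasSphereContraction.homology {X : Set (Finset V)} (hX : IsComplex X) {d : ℕ}
    (h : HasSphereContraction X d) :
    Nonempty (Hgrp X d ≃ₗ[ℤ] ℤ) ∧ ∀ n, n ≠ d → Subsingleton (Hgrp X n) := by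
  obtain ⟨z, r, h, hz, hdz, hrz, hh⟩ := h
  have key : ∀ n, ∀ c ∈ chainsOn {s | s ∈ X ∧ s.card = n}, dif c = 0 →
      ∃ y ∈ chainsOn {s | s ∈ X ∧ s.card = n + 1},
        dif y = c - r c • chainProj {s | s.card = n} z := by
    intro n c hc hdc
    obtain ⟨-, h2, h3⟩ := hh c (chainsOn_mono (fun _ hs => hs.1) hc)
    refine ⟨_, chainProj_card_mem h2 (n + 1), ?_⟩
    rw [hdc, map_zero, add_zero] at h3
    rw [chainProj_card_succ_dif, h3, map_sub, map_smul, chainProj_card_of_mem hc]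
  refine ⟨(nonempty_Hgrp_equiv_iff hX d).2 ⟨z, hz, hdz, fun c hc hdc => ?_, fun k y hy hk => ?_⟩,
    fun n hn => (subsingleton_Hgrp_iff hX n).2 fun c hc hdc => ?_⟩
  · obtain ⟨y, hy, h⟩ := key d c hc hdc
    exact ⟨r c, y, hy, by rw [h, chainProj_card_of_mem hz]⟩
  · have h1 := (hh y (chainsOn_mono (fun _ hs => hs.1) hy)).1
    rw [hk, map_smul, hrz] at h1
    simpa using h1
  · obtain ⟨y, hy, h⟩ := key n c hc hdc
    exact ⟨y, hy, by rw [h, chainProj_card_of_mem_of_ne hz hn, smul_zero, sub_zero]⟩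

/-- A finite complex with the homology of a sphere has a sphere contraction. -/
theorem HasSphereContraction.of_homology {X : Set (Finset V)} (hX : IsComplex X)
    (hfin : X.Finite) {d : ℕ} (hd : Nonempty (Hgrp X d ≃ₗ[ℤ] ℤ))
    (ho : ∀ n, n ≠ d → Subsingleton (Hgrp X n)) : HasSphereContraction X d := by
  obtain ⟨z, hz, hdz, hsurj, hinj⟩ := (nonempty_Hgrp_equiv_iff hX d).1 hd
  have hzX : z ∈ chainsOn X := chainsOn_mono (fun _ hs => hs.1) hz
  have hsub : ∀ n, ∀ y ∈ chainsOn {s | s ∈ X ∧ s.card = n + 1}, y ∈ chainsOn X :=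
    fun n y hy => chainsOn_mono (fun _ hs => hs.1) hy
  -- the module of cycles is free, so cycles decompose linearly
  let Z : Submodule ℤ (AmbientChain V) := chainsOn X ⊓ LinearMap.ker dif
  have : Finite X := hfin
  have : Module.Finite ℤ (chainsOn X) :=
    Module.Finite.equiv (Finsupp.supportedEquivFinsupp (M := ℤ) (R := ℤ) X).symm
  have : Module.Finite ℤ Z :=
    Module.Finite.of_injective (Submodule.inclusion (inf_le_left : Z ≤ chainsOn X))
      (Submodule.inclusion_injective _)
  have hmemZ : ∀ p : ℤ × chainsOn X, p.1 • z + dif p.2.1 ∈ Z := fun p =>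
    ⟨Submodule.add_mem _ (Submodule.smul_mem _ _ hzX) (dif_mem hX p.2.2), LinearMap.mem_ker.2 (by
      rw [map_add, map_smul, hdz, dif_dif, smul_zero, add_zero])⟩
  let Ψ : ℤ × chainsOn X →ₗ[ℤ] Z :=
    LinearMap.codRestrict Z ((LinearMap.toSpanSingleton ℤ _ z).coprod (dif ∘ₗ (chainsOn X).subtype))
      hmemZ
  have hΨ : ∀ k y, (Ψ (k, y)).1 = k • z + dif y.1 := fun _ _ => rfl
  have hpart : ∀ n, ∀ c ∈ Z, ∃ k : ℤ, ∃ y ∈ chainsOn X,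
      chainProj {s | s.card = n} c = k • z + dif y := by
    rintro n c ⟨hc, hdc⟩
    have hcn := chainProj_card_mem hc n
    have hdcn : dif (chainProj {s | s.card = n} c) = 0 := by
      cases n with
      | zero =>
        refine (Submodule.mem_bot ℤ).1 (map_mem_of_face_mem (fun s hs => ?_) hcn)
        rw [Finset.card_eq_zero.1 hs.2, dif_face_empty]
        exact Submodule.zero_mem _
      | succ n => rw [chainProj_card_succ_dif, LinearMap.mem_ker.1 hdc, map_zero]
    by_cases hn : n = d
    · subst hn
      obtain ⟨k, y, hy, h⟩ := hsurj _ hcn hdcn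
      exact ⟨k, y, hsub _ y hy, by rw [h]; abel⟩
    · obtain ⟨y, hy, h⟩ := (subsingleton_Hgrp_iff hX n).1 (ho n hn) _ hcn hdcn
      exact ⟨0, y, hsub _ y hy, by rw [h]; simp⟩
  have hΨsurj : Function.Surjective Ψ := by
    rintro ⟨c, hc⟩
    choose k y hy hky using fun n => hpart n c hc
    obtain ⟨N, hN⟩ := exists_sum_chainProj_card c
    refine ⟨(∑ n ∈ Finset.range N, k n, ∑ n ∈ Finset.range N, ⟨y n, hy n⟩), Subtype.ext ?_⟩
    rw [hΨ]
    refine Eq.trans ?_ hN.symm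
    simp only [hky, Finset.sum_add_distrib, Finset.sum_smul]
    simp
  obtain ⟨σ, hσ⟩ := Module.projective_lifting_property Ψ LinearMap.id hΨsurj
  let k : Z →ₗ[ℤ] ℤ := LinearMap.fst ℤ _ _ ∘ₗ σ
  let s : Z →ₗ[ℤ] AmbientChain V := (chainsOn X).subtype ∘ₗ LinearMap.snd ℤ _ _ ∘ₗ σ
  have hs : ∀ c, s c ∈ chainsOn X := fun c => (σ c).2.2
  have hks : ∀ c : Z, c.1 = k c • z + dif (s c) := fun c =>
    (congrArg Subtype.val (LinearMap.congr_fun hσ c)).symm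
  have hzero : ∀ j : ℤ, ∀ y ∈ chainsOn X, dif y = j • z → j = 0 := fun j y hy h =>
    hinj j _ (chainProj_card_mem hy (d + 1)) (by
      rw [chainProj_card_succ_dif, h, map_smul, chainProj_card_of_mem hz])
  have hk : ∀ c : Z, ∀ y ∈ chainsOn X, dif y = c.1 → k c = 0 := fun c y hy h =>
    hzero _ (y - s c) (Submodule.sub_mem _ hy (hs c)) (by
      rw [map_sub, h]; nth_rewrite 1 [hks c]; abel)
  have hpmem : ∀ x, chainProj X x ∈ chainsOn X := fun x =>
    chainsOn_mono (fun _ hs => hs.2) (chainProj_mem (X := X) (mem_chainsOn_univ x))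
  let D : AmbientChain V →ₗ[ℤ] Z := LinearMap.codRestrict Z (dif ∘ₗ chainProj X)
    fun x => ⟨dif_mem hX (hpmem x), dif_dif _⟩
  have hD : ∀ x ∈ chainsOn X, (D x).1 = dif x := fun x hx => by
    change dif (chainProj X x) = dif x
    rw [chainProj_of_mem hx]
  let c : AmbientChain V →ₗ[ℤ] Z := LinearMap.codRestrict Z (chainProj X - s ∘ₗ D)
    fun x => ⟨Submodule.sub_mem _ (hpmem x) (hs _), LinearMap.mem_ker.2 (by
      have h1 := hks (D x)
      have h2 : k (D x) = 0 := hk _ _ (hpmem x) rfl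
      rw [h2, zero_smul, zero_add] at h1
      rw [LinearMap.sub_apply, map_sub, LinearMap.comp_apply, ← h1]
      exact sub_self _)⟩
  have hc : ∀ x ∈ chainsOn X, (c x).1 = x - s (D x) := fun x hx => by
    change chainProj X x - s (D x) = x - s (D x)
    rw [chainProj_of_mem hx]
  have hDcyc : ∀ x ∈ chainsOn X, dif x = 0 → D x = 0 := fun x hx h =>
    Subtype.ext ((hD x hx).trans h)
  have hccyc : ∀ x ∈ chainsOn X, dif x = 0 → (c x).1 = x := fun x hx h => by
    rw [hc x hx, hDcyc x hx h, map_zero, sub_zero]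
  refine ⟨z, k ∘ₗ c, s ∘ₗ c, hz, hdz, ?_, fun x hx => ⟨?_, hs _, ?_⟩⟩
  · have h1 := hks (c z)
    rw [hccyc z hzX hdz] at h1
    have h2 := hzero (1 - k (c z)) (s (c z)) (hs _) (by
      rw [sub_smul, one_smul, eq_sub_iff_add_eq, add_comm]; exact h1.symm)
    rw [LinearMap.comp_apply]
    omega
  · exact hk _ x hx (hccyc _ (dif_mem hX hx) (dif_dif x)).symm
  · have h1 := hks (c x)
    have h2 : c (dif x) = D x :=
      Subtype.ext ((hccyc _ (dif_mem hX hx) (dif_dif x)).trans (hD x hx).symm)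
    rw [hc x hx] at h1
    simp only [LinearMap.comp_apply]
    rw [h2, eq_sub_iff_add_eq, add_right_comm, add_comm (dif _), ← h1]
    abel

end Ambient

/-! ### Composition complexes -/

theorem mem_compU_iff {m : ℕ} {B : Fin m → Finset ℕ} {K : Set (Finset (Fin m))}
    {L : Fin m → Set (Finset ℕ)} {s : Finset ℕ} :
    s ∈ compU B K (fun k => fullOn (B k)) L ↔
      s ⊆ Finset.univ.biUnion B ∧ ∃ τ ∈ K, ∀ k, s ∩ B k ∉ L k → k ∈ τ := by
  simp only [compU, joinU, Set.mem_iUnion, Set.mem_ofPred_eq, exists_prop]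
  constructor
  · rintro ⟨τ, hτ, hs, h⟩
    refine ⟨hs, τ, hτ, fun k hk => by_contra fun hkτ => hk ?_⟩
    simpa [hkτ] using h k
  · rintro ⟨hs, τ, hτ, h⟩
    refine ⟨τ, hτ, hs, fun k => ?_⟩
    by_cases hk : k ∈ τ
    · simp [hk, fullOn]
    · simpa [hk] using not_imp_comm.1 (h k) hk

theorem isComplex_compU {m : ℕ} {B : Fin m → Finset ℕ} {K : Set (Finset (Fin m))}
    {L : Fin m → Set (Finset ℕ)} (hL : ∀ k, IsComplex (L k)) :
    IsComplex (compU B K (fun k => fullOn (B k)) L) := by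
  intro s hs t hts
  rw [mem_compU_iff] at hs ⊢
  obtain ⟨hs, τ, hτ, h⟩ := hs
  exact ⟨hts.trans hs, τ, hτ, fun k hk => h k fun hsk =>
    hk (hL k _ hsk _ (Finset.inter_subset_inter_right hts))⟩

/-- The simplices outside the block `j` all of whose bad blocks, together with `σ`, lie in a
common face of `K`. -/
def awayFrom {m : ℕ} (B : Fin m → Finset ℕ) (K : Set (Finset (Fin m)))
    (L : Fin m → Set (Finset ℕ)) (j : Fin m) (σ : Finset (Fin m)) : Set (Finset ℕ) :=
  {t | t ⊆ (Finset.univ.erase j).biUnion B ∧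
    ∃ τ ∈ K, σ ⊆ τ ∧ ∀ k, k ≠ j → t ∩ B k ∉ L k → k ∈ τ}

theorem awayFrom_congr {m : ℕ} {B B' : Fin m → Finset ℕ} {K : Set (Finset (Fin m))}
    {L L' : Fin m → Set (Finset ℕ)} {j : Fin m} (hB : ∀ k, k ≠ j → B k = B' k)
    (hL : ∀ k, k ≠ j → L k = L' k) (σ : Finset (Fin m)) :
    awayFrom B K L j σ = awayFrom B' K L' j σ := by
  have hU : (Finset.univ.erase j).biUnion B = (Finset.univ.erase j).biUnion B' :=
    Finset.biUnion_congr rfl fun k hk => hB k (Finset.ne_of_mem_erase hk)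
  have hP : ∀ t : Finset ℕ, ∀ τ : Finset (Fin m), (∀ k, k ≠ j → t ∩ B k ∉ L k → k ∈ τ) ↔
      ∀ k, k ≠ j → t ∩ B' k ∉ L' k → k ∈ τ := fun t τ =>
    forall_congr' fun k => forall_congr' fun hk => by rw [hB k hk, hL k hk]
  ext t
  simp only [awayFrom, Set.mem_ofPred_eq, hU, hP]

theorem disjoint_of_mem_awayFrom {m : ℕ} {B : Fin m → Finset ℕ} {K : Set (Finset (Fin m))}
    {L : Fin m → Set (Finset ℕ)} {j : Fin m} {σ : Finset (Fin m)} {C t : Finset ℕ}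
    (hC : ∀ k, k ≠ j → Disjoint (B k) C) (ht : t ∈ awayFrom B K L j σ) : Disjoint t C :=
  ((Finset.disjoint_biUnion_left _ _ _).2 fun k hk => hC k (Finset.ne_of_mem_erase hk)).mono_left
    ht.1

theorem compU_eq_blockJoin {m : ℕ} {B : Fin m → Finset ℕ} {j : Fin m}
    (hB : ∀ k, k ≠ j → Disjoint (B k) (B j)) (K : Set (Finset (Fin m)))
    (L : Fin m → Set (Finset ℕ)) :
    compU B K (fun k => fullOn (B k)) L =
      blockJoin (B j) (L j) (awayFrom B K L j {j}) (awayFrom B K L j ∅) := by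
  have hinter : ∀ s : Finset ℕ, ∀ k, k ≠ j → (s \ B j) ∩ B k = s ∩ B k := fun s k hk => by
    have := Finset.disjoint_left.1 (hB k hk)
    ext x
    simp only [Finset.mem_inter, Finset.mem_sdiff]
    tauto
  have hsub : ∀ s : Finset ℕ, s \ B j ⊆ (Finset.univ.erase j).biUnion B ↔
      s ⊆ Finset.univ.biUnion B := fun s => by
    rw [← Finset.insert_erase (Finset.mem_univ j), Finset.biUnion_insert,
      Finset.erase_insert (Finset.notMem_erase j _)]
    exact sdiff_le_iff
  have haway : ∀ (s : Finset ℕ) (σ : Finset (Fin m)), s \ B j ∈ awayFrom B K L j σ ↔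
      s ⊆ Finset.univ.biUnion B ∧ ∃ τ ∈ K, σ ⊆ τ ∧ ∀ k, k ≠ j → s ∩ B k ∉ L k → k ∈ τ :=
    fun s σ => and_congr (hsub s) (exists_congr fun τ => and_congr_right fun _ =>
      and_congr_right fun _ => forall_congr' fun k => forall_congr' fun hk => by
        rw [hinter s k hk])
  ext s
  change _ ↔ s \ B j ∈ awayFrom B K L j ∅ ∧ (s ∩ B j ∈ L j ∨ s \ B j ∈ awayFrom B K L j {j})
  rw [mem_compU_iff, haway, haway]
  constructor
  · rintro ⟨hs, τ, hτ, h⟩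
    refine ⟨⟨hs, τ, hτ, Finset.empty_subset _, fun k _ => h k⟩, ?_⟩
    by_cases hj : s ∩ B j ∈ L j
    · exact Or.inl hj
    · exact Or.inr ⟨hs, τ, hτ, Finset.singleton_subset_iff.2 (h j hj), fun k _ => h k⟩
  · rintro ⟨⟨hs, τ, hτ, -, h⟩, hj | ⟨-, τ', hτ', hjτ', h'⟩⟩
    · refine ⟨hs, τ, hτ, fun k hk => h k ?_ hk⟩
      rintro rfl
      exact hk hj
    · refine ⟨hs, τ', hτ', fun k hk => ?_⟩
      by_cases hkj : k = j
      · subst hkj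
        exact Finset.singleton_subset_iff.1 hjτ'
      · exact h' k hkj hk

/-- Replacing the point `v` carrying the complex `{∅}` at the block `j` by a block `B j` carrying
a homology sphere. -/
theorem HasSphereContraction.compU_update {m : ℕ} {B : Fin m → Finset ℕ}
    {K : Set (Finset (Fin m))} {L : Fin m → Set (Finset ℕ)} {j : Fin m}
    (hB : ∀ k, k ≠ j → Disjoint (B k) (B j)) (hne : (B j).Nonempty) (hL : IsComplex (L j))
    (hLB : ∀ s ∈ L j, s ⊆ B j) {B' : Fin m → Finset ℕ} {L' : Fin m → Set (Finset ℕ)}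
    (hBB' : ∀ k, k ≠ j → B k = B' k) (hLL' : ∀ k, k ≠ j → L k = L' k) {v : ℕ} (hv : B' j = {v})
    (hL' : L' j = {∅}) (hvB : ∀ k, k ≠ j → Disjoint (B k) {v}) {b d : ℕ}
    (h : HasSphereContraction (L j) b)
    (h' : HasSphereContraction (compU B' K (fun k => fullOn (B' k)) L') d) :
    HasSphereContraction (compU B K (fun k => fullOn (B k)) L) (d + b) := by
  rw [compU_eq_blockJoin (j := j) (fun k hk => by rw [hv, ← hBB' k hk]; exact hvB k hk), hv, hL',
    ← awayFrom_congr hBB' hLL', ← awayFrom_congr hBB' hLL'] at h'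
  rw [compU_eq_blockJoin hB]
  exact HasSphereContraction.blockJoin hne hL hLB (fun t ht => disjoint_of_mem_awayFrom hB ht)
    (fun t ht => Finset.disjoint_singleton_right.1 (disjoint_of_mem_awayFrom hvB ht)) h h'

theorem HasSphereContraction.compU_points {m : ℕ} {K : Set (Finset (Fin m))} {a : ℕ}
    (h : HasSphereContraction K a) (hK : IsComplex K) (N : ℕ) :
    HasSphereContraction (compU (fun k : Fin m => {N + k.1}) K (fun k => fullOn {N + k.1})
      fun _ => {∅}) a := by
  let f : Fin m ↪o ℕ := Fin.valOrderEmb m |>.trans (OrderEmbedding.ofStrictMono (N + ·)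
    fun _ _ hxy => Nat.add_lt_add_left hxy N)
  have hf : ∀ k, f k = N + k.1 := fun _ => rfl
  have hbad : ∀ (s : Finset ℕ) (k : Fin m), s ∩ {N + k.1} ∉ ({∅} : Set (Finset ℕ)) ↔ f k ∈ s :=
    fun s k => by
      rw [Set.mem_singleton_iff, ← Finset.disjoint_iff_inter_eq_empty,
        Finset.disjoint_singleton_right, not_not, hf]
  have himage : compU (fun k : Fin m => {N + k.1}) K (fun k => fullOn {N + k.1})
      (fun _ => {∅}) = {s | ∃ t ∈ K, t.map f.toEmbedding = s} := by
    ext s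
    rw [mem_compU_iff]
    simp only [hbad, Set.mem_ofPred_eq]
    constructor
    · rintro ⟨hs, τ, hτ, h⟩
      refine ⟨Finset.univ.filter (f · ∈ s), hK τ hτ _ fun k hk => h k (Finset.mem_filter.1 hk).2,
        ?_⟩
      ext x
      simp only [Finset.mem_map, Finset.mem_filter, Finset.mem_univ, true_and]
      constructor
      · rintro ⟨k, hk, rfl⟩
        exact hk
      · intro hx
        obtain ⟨k, -, hk⟩ := Finset.mem_biUnion.1 (hs hx)
        obtain rfl := Finset.mem_singleton.1 hk
        exact ⟨k, hx, rfl⟩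
    · rintro ⟨t, ht, rfl⟩
      refine ⟨fun x hx => ?_, t, ht, fun k hk => (Finset.mem_map' _).1 hk⟩
      obtain ⟨k, -, rfl⟩ := Finset.mem_map.1 hx
      exact Finset.mem_biUnion.2 ⟨k, Finset.mem_univ k, Finset.mem_singleton_self _⟩
  rw [himage]
  exact h.map f

theorem HasSphereContraction.compU {m : ℕ} {B : Fin m → Finset ℕ}
    (hBd : ∀ k l, k ≠ l → Disjoint (B k) (B l)) (hBne : ∀ k, (B k).Nonempty)
    {K : Set (Finset (Fin m))} (hK : IsComplex K)
    {L : Fin m → Set (Finset ℕ)} (hL : ∀ k, IsComplex (L k)) (hLv : ∀ k, ∀ s ∈ L k, s ⊆ B k)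
    {a : ℕ} {b : Fin m → ℕ} (ha : HasSphereContraction K a)
    (hb : ∀ k, HasSphereContraction (L k) (b k)) :
    HasSphereContraction (compU B K (fun k => fullOn (B k)) L) (a + ∑ k, b k) := by
  obtain ⟨N, hN⟩ : ∃ N, ∀ k, ∀ x ∈ B k, x < N :=
    ⟨(Finset.univ.biUnion B).sup id + 1, fun k x hx => Nat.lt_succ_of_le
      (Finset.le_sup (f := id) (Finset.mem_biUnion.2 ⟨k, Finset.mem_univ k, hx⟩))⟩
  let BU : Finset (Fin m) → Fin m → Finset ℕ := fun U k => if k ∈ U then B k else {N + k.1}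
  let LU : Finset (Fin m) → Fin m → Set (Finset ℕ) := fun U k => if k ∈ U then L k else {∅}
  have hBN : ∀ k l, Disjoint (B k) {N + l} := fun k l => by
    rw [Finset.disjoint_singleton_right]
    intro h
    have := hN k _ h
    omega
  have key : ∀ U : Finset (Fin m), HasSphereContraction
      (_root_.compU (BU U) K (fun k => fullOn (BU U k)) (LU U)) (a + ∑ k ∈ U, b k) := by
    intro U
    induction U using Finset.induction_on with
    | empty => simpa [BU, LU] using ha.compU_points hK N
    | insert j U hj ih =>
      have hBj : BU (insert j U) j = B j := if_pos (Finset.mem_insert_self j U)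
      have hLj : LU (insert j U) j = L j := if_pos (Finset.mem_insert_self j U)
      rw [Finset.sum_insert hj, add_comm (b j), ← add_assoc]
      refine HasSphereContraction.compU_update (j := j) (v := N + j.1) ?_ ?_ ?_ ?_ ?_ ?_
        (if_neg hj) (if_neg hj) ?_ ?_ ih
      · intro k hk
        rw [hBj]
        by_cases hkU : k ∈ U
        · simpa [BU, hkU] using hBd k j hk
        · simpa [BU, hkU, hk] using (hBN j k).symm
      · rw [hBj]
        exact hBne j
      · rw [hLj]
        exact hL j
      · rw [hBj, hLj]
        exact hLv j
      · intro k hk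
        simp [BU, hk]
      · intro k hk
        simp [LU, hk]
      · intro k hk
        by_cases hkU : k ∈ U
        · simpa [BU, hkU] using hBN k j
        · have hkj : k.1 ≠ j.1 := Fin.val_ne_of_ne hk
          simpa [BU, hkU, hk] using hkj
      · rw [hLj]
        exact hb j
  simpa [BU, LU] using key Finset.univ

/-- If `K` and each `L k` are homology spheres — reduced homology isomorphic to
`ℤ` concentrated in a single (shifted) degree — then the composition complex
`S(K; L₁, …, L_m)` is a homology sphere, concentrated in the (shifted) degree
`a + b₁ + ⋯ + b_m` (i.e. unshifted degree `(a-1) + ∑ (b_k - 1) + m`). -/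
theorem homologySphere_compU (m : ℕ) (B : Fin m → Finset ℕ)
    (hBd : ∀ k l, k ≠ l → Disjoint (B k) (B l)) (hBne : ∀ k, (B k).Nonempty)
    (K : Set (Finset (Fin m))) (hK : IsComplex K)
    (L : Fin m → Set (Finset ℕ)) (hL : ∀ k, IsComplex (L k))
    (hLv : ∀ k, ∀ s ∈ L k, s ⊆ B k)
    (a : ℕ) (b : Fin m → ℕ)
    (hKa : Nonempty (Hgrp K a ≃ₗ[ℤ] ℤ))
    (hKo : ∀ n, n ≠ a → Subsingleton (Hgrp K n))
    (hLb : ∀ k, Nonempty (Hgrp (L k) (b k) ≃ₗ[ℤ] ℤ))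
    (hLo : ∀ k, ∀ n, n ≠ b k → Subsingleton (Hgrp (L k) n)) :
    Nonempty (Hgrp (compU B K (fun k => fullOn (B k)) L) (a + ∑ k, b k)
        ≃ₗ[ℤ] ℤ) ∧
    ∀ n, n ≠ a + ∑ k, b k →
      Subsingleton (Hgrp (compU B K (fun k => fullOn (B k)) L) n) := by
  have hfin : ∀ k, (L k).Finite := fun k =>
    (B k).powerset.finite_toSet.subset fun s hs => Finset.mem_powerset.2 (hLv k s hs)
  exact (HasSphereContraction.compU hBd hBne hK hL hLv
    (HasSphereContraction.of_homology hK (Set.toFinite _) hKa hKo) fun k =>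
      HasSphereContraction.of_homology (hL k) (hfin k) (hLb k) (hLo k)).homology
    (isComplex_compU hL)
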